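/- arXiv:1604.02736 — 2 statements merged into one kernel-verified Lean document; each statement's English description precedes it below -/
import Mathlib

section
/- Let (x_i, y_i), i = 1,…,n, be real pairs with x_1 < … < x_n and ν̂² > 0, let m = ⌈n^{1/2}⌉ ≤ n, suppose every slicing scheme S with minimum slice size m_S ≥ m has all per-slice residual variances strictly positive, and let λ0 > 0. Then BF*(λ0) = [Σ_{S: m_S ≥ m} n^{−λ0(|S|−1)/2}]^{−1} Σ_{S: m_S ≥ m} exp((n/2) D(Y|S, λ0)) is a convex combination of the LR_S and satisfies BF*(λ0) ≥ 1; consequently 0 ≤ G_t²(Y|X, λ0) = 1 − BF*(λ0)^{−2/n} < 1. -/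
open Real Finset

/-- Residual sum of squares of least-squares simple linear regression of `y` on `x`
over the index set `s`. -/
noncomputable def slRSS (x y : ℕ → ℝ) (s : Finset ℕ) : ℝ :=
  sInf {v | ∃ a b : ℝ, v = ∑ i ∈ s, (y i - a - b * x i) ^ 2}

/-- Per-slice residual variance. -/
noncomputable def sliceVar (x y : ℕ → ℝ) (s : Finset ℕ) : ℝ := slRSS x y s / s.card

/-- Slice `h` of the slicing scheme of `{1,…,n}` given by the composition `c`. -/
def cslice {n : ℕ} (c : Composition n) (h : Fin c.length) : Finset ℕ :=
  Finset.Ioc (c.sizeUpTo h) (c.sizeUpTo (h + 1))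

/-- Sample mean of `y_1, …, y_n`. -/
noncomputable def ybarN (y : ℕ → ℝ) (n : ℕ) : ℝ := (∑ i ∈ Finset.Icc 1 n, y i) / n

/-- Overall sample variance `ν̂²` of `y_1, …, y_n`. -/
noncomputable def nuHat (y : ℕ → ℝ) (n : ℕ) : ℝ :=
  (∑ i ∈ Finset.Icc 1 n, (y i - ybarN y n) ^ 2) / n

/-- The likelihood ratio `LR_S = exp((n/2) log ν̂² − ∑_h (n_h/2) log σ̂²_h)`. -/
noncomputable def LRstat (x y : ℕ → ℝ) (n : ℕ) (c : Composition n) : ℝ :=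
  Real.exp ((n / 2 : ℝ) * Real.log (nuHat y n)
    - ∑ h : Fin c.length, ((c.blocksFun h : ℝ) / 2) * Real.log (sliceVar x y (cslice c h)))

/-- `D(Y|S,λ0) = (2 log LR_S − λ0(|S|−1) log n)/n`. -/
noncomputable def Dstat (x y : ℕ → ℝ) (n : ℕ) (c : Composition n) (lam0 : ℝ) : ℝ :=
  ((n : ℝ) * Real.log (nuHat y n)
    - ∑ h : Fin c.length, (c.blocksFun h : ℝ) * Real.log (sliceVar x y (cslice c h))
    - lam0 * ((c.length : ℝ) - 1) * Real.log n) / n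

/-- The admissible slicing schemes: compositions of `n` with all slices of size `≥ m`. -/
noncomputable def admissible (n m : ℕ) : Finset (Composition n) :=
  Finset.univ.filter fun c => ∀ h, m ≤ c.blocksFun h

/-- The prior weight `n^{−λ0(|S|−1)/2}` of a slicing scheme. -/
noncomputable def priorWeight (n : ℕ) (lam0 : ℝ) (c : Composition n) : ℝ :=
  (n : ℝ) ^ (-(lam0 * ((c.length : ℝ) - 1)) / 2)

/-- `BF*(λ0) = (∑_S n^{−λ0(|S|−1)/2})⁻¹ ∑_S exp((n/2) D(Y|S,λ0))`. -/
noncomputable def BFstar (x y : ℕ → ℝ) (n m : ℕ) (lam0 : ℝ) : ℝ :=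
  (∑ c ∈ admissible n m, priorWeight n lam0 c)⁻¹ *
    ∑ c ∈ admissible n m, Real.exp ((n / 2 : ℝ) * Dstat x y n c lam0)

/-- `G_t²(Y|X,λ0) = 1 − BF*(λ0)^{−2/n}`. -/
noncomputable def GtSq (x y : ℕ → ℝ) (n m : ℕ) (lam0 : ℝ) : ℝ :=
  1 - BFstar x y n m lam0 ^ (-(2 : ℝ) / n)

lemma aux_sum_slices {n : ℕ} (c : Composition n) (f : ℕ → ℝ) :
    ∑ h : Fin c.length, ∑ i ∈ cslice c h, f i = ∑ i ∈ Finset.Icc 1 n, f i := by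
  have key : ∀ k : ℕ, ∑ j ∈ Finset.range k,
      ∑ i ∈ Finset.Ioc (c.sizeUpTo j) (c.sizeUpTo (j + 1)), f i
      = ∑ i ∈ Finset.Ioc 0 (c.sizeUpTo k), f i := by
    intro k
    induction k with
    | zero => simp
    | succ k ih =>
      rw [Finset.sum_range_succ, ih]
      exact Finset.sum_Ioc_consecutive f (Nat.zero_le _) (c.monotone_sizeUpTo (Nat.le_succ k))
  have h1 := key c.length
  rw [c.sizeUpTo_length, Finset.sum_range] at h1
  exact h1

lemma aux_card {n : ℕ} (c : Composition n) (h : Fin c.length) :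
    (cslice c h).card = c.blocksFun h := by
  have := c.sizeUpTo_succ' h
  simp [cslice, this]

lemma aux_RSS_le (x y : ℕ → ℝ) (s : Finset ℕ) (a : ℝ) :
    slRSS x y s ≤ ∑ i ∈ s, (y i - a) ^ 2 := by
  apply csInf_le
  · refine ⟨0, ?_⟩
    rintro v ⟨a, b, rfl⟩
    positivity
  · exact ⟨a, 0, by simp⟩

lemma aux_one_le_LR (n : ℕ) (hn : 0 < n) (x y : ℕ → ℝ) (c : Composition n)
    (hσ : ∀ h : Fin c.length, 0 < sliceVar x y (cslice c h)) :
    1 ≤ LRstat x y n c := by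
  have hn' : (0 : ℝ) < n := by exact_mod_cast hn
  have hsum : ∑ h : Fin c.length, (c.blocksFun h : ℝ) = n := by
    exact_mod_cast c.sum_blocksFun
  have hlog := strictConcaveOn_log_Ioi.concaveOn.le_map_sum (t := Finset.univ)
    (w := fun h : Fin c.length => (c.blocksFun h : ℝ) / n)
    (p := fun h => sliceVar x y (cslice c h))
    (fun h _ => by positivity)
    (by rw [← Finset.sum_div, hsum, div_self hn'.ne'])
    (fun h _ => hσ h)
  simp only [smul_eq_mul] at hlog
  have hle : ∑ h : Fin c.length, (c.blocksFun h : ℝ) / n * sliceVar x y (cslice c h)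
      ≤ nuHat y n := by
    unfold nuHat
    rw [← aux_sum_slices c, Finset.sum_div]
    apply Finset.sum_le_sum
    intro h _
    have hb : (0 : ℝ) < c.blocksFun h := by exact_mod_cast c.one_le_blocksFun h
    rw [sliceVar, aux_card]
    have := aux_RSS_le x y (cslice c h) (ybarN y n)
    have e : (c.blocksFun h : ℝ) / n * (slRSS x y (cslice c h) / c.blocksFun h)
      = slRSS x y (cslice c h) / n := by field_simp
    rw [e]
    gcongr
  have hpos : 0 < ∑ h : Fin c.length, (c.blocksFun h : ℝ) / n * sliceVar x y (cslice c h) := by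
    apply Finset.sum_pos
    · intro h _
      have hb : (0 : ℝ) < c.blocksFun h := by exact_mod_cast c.one_le_blocksFun h
      have := hσ h
      positivity
    · exact ⟨⟨0, c.length_pos_of_pos hn⟩, Finset.mem_univ _⟩
  have h3 := hlog.trans (Real.log_le_log hpos hle)
  have h4 : ∑ h : Fin c.length, ((c.blocksFun h : ℝ) / 2) * Real.log (sliceVar x y (cslice c h))
      = (n / 2 : ℝ) * ∑ h : Fin c.length,
        (c.blocksFun h : ℝ) / n * Real.log (sliceVar x y (cslice c h)) := by
    rw [Finset.mul_sum]
    refine Finset.sum_congr rfl fun h _ => ?_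
    field_simp
  unfold LRstat
  rw [Real.one_le_exp_iff, h4, ← mul_sub]
  exact mul_nonneg (by positivity) (sub_nonneg.2 h3)

lemma aux_exp (n : ℕ) (hn : 0 < n) (x y : ℕ → ℝ) (c : Composition n) (lam0 : ℝ) :
    Real.exp ((n / 2 : ℝ) * Dstat x y n c lam0) = priorWeight n lam0 c * LRstat x y n c := by
  have hn' : (0 : ℝ) < n := by exact_mod_cast hn
  unfold priorWeight LRstat Dstat
  rw [Real.rpow_def_of_pos hn', ← Real.exp_add]
  have : ∑ h : Fin c.length, ((c.blocksFun h : ℝ) / 2) * Real.log (sliceVar x y (cslice c h))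
      = (∑ h : Fin c.length, (c.blocksFun h : ℝ) * Real.log (sliceVar x y (cslice c h))) / 2 := by
    rw [Finset.sum_div]
    exact Finset.sum_congr rfl fun h _ => by ring
  rw [this]
  congr 1
  field_simp
  ring

/-- `BF*(λ0)` is a convex combination of the likelihood ratios `LR_S`
over admissible slicing schemes, hence `BF*(λ0) ≥ 1`, and consequently
`0 ≤ G_t²(Y|X,λ0) < 1`. -/
theorem BFstar_convex_combination_and_GtSq_mem_Ico (n : ℕ) (x y : ℕ → ℝ)
    (hsort : ∀ i j : ℕ, 1 ≤ i → i < j → j ≤ n → x i < x j)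
    (hν : 0 < nuHat y n)
    (m : ℕ) (hm : m = ⌈Real.sqrt n⌉₊) (hmn : m ≤ n)
    (hσ : ∀ c : Composition n, (∀ h, m ≤ c.blocksFun h) →
      ∀ h : Fin c.length, 0 < sliceVar x y (cslice c h))
    (lam0 : ℝ) (hlam0 : 0 < lam0) :
    (∀ c ∈ admissible n m,
        0 ≤ priorWeight n lam0 c / ∑ c' ∈ admissible n m, priorWeight n lam0 c')
    ∧ (∑ c ∈ admissible n m,
        priorWeight n lam0 c / ∑ c' ∈ admissible n m, priorWeight n lam0 c') = 1
    ∧ BFstar x y n m lam0 =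
        ∑ c ∈ admissible n m,
          (priorWeight n lam0 c / ∑ c' ∈ admissible n m, priorWeight n lam0 c') *
            LRstat x y n c
    ∧ 1 ≤ BFstar x y n m lam0
    ∧ 0 ≤ GtSq x y n m lam0 ∧ GtSq x y n m lam0 < 1 := by
  have hn : 0 < n := by
    rcases Nat.eq_zero_or_pos n with h | h
    · subst h; simp [nuHat] at hν
    · exact h
  have hn' : (0 : ℝ) < n := by exact_mod_cast hn
  have hw : ∀ c : Composition n, 0 < priorWeight n lam0 c := fun c => Real.rpow_pos_of_pos hn' _
  have hne : (admissible n m).Nonempty := by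
    refine ⟨Composition.single n hn, ?_⟩
    simp only [admissible, Finset.mem_filter, Finset.mem_univ, true_and]
    intro h
    simpa using hmn
  have hW : 0 < ∑ c' ∈ admissible n m, priorWeight n lam0 c' :=
    Finset.sum_pos (fun c _ => hw c) hne
  have h1 : ∀ c ∈ admissible n m,
        0 ≤ priorWeight n lam0 c / ∑ c' ∈ admissible n m, priorWeight n lam0 c' :=
    fun c _ => div_nonneg (hw c).le hW.le
  have h2 : (∑ c ∈ admissible n m,
        priorWeight n lam0 c / ∑ c' ∈ admissible n m, priorWeight n lam0 c') = 1 := by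
    rw [← Finset.sum_div, div_self hW.ne']
  have h3 : BFstar x y n m lam0 =
        ∑ c ∈ admissible n m,
          (priorWeight n lam0 c / ∑ c' ∈ admissible n m, priorWeight n lam0 c') *
            LRstat x y n c := by
    unfold BFstar
    rw [Finset.mul_sum]
    refine Finset.sum_congr rfl fun c _ => ?_
    rw [aux_exp n hn]
    ring
  have h4 : 1 ≤ BFstar x y n m lam0 := by
    rw [h3]
    nth_rewrite 1 [← h2]
    refine Finset.sum_le_sum fun c hc => ?_
    refine le_mul_of_one_le_right (h1 c hc) (aux_one_le_LR n hn x y c (hσ c ?_))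
    simpa [admissible] using hc
  refine ⟨h1, h2, h3, h4, ?_, ?_⟩
  · have : BFstar x y n m lam0 ^ (-(2 : ℝ) / n) ≤ 1 :=
      Real.rpow_le_one_of_one_le_of_nonpos h4
        (div_nonpos_of_nonpos_of_nonneg (by norm_num) hn'.le)
    unfold GtSq
    linarith
  · have : 0 < BFstar x y n m lam0 ^ (-(2 : ℝ) / n) := Real.rpow_pos_of_pos (by linarith) _
    unfold GtSq
    linarith
end

section
/- Let n ≥ 1, 1 ≤ m ≤ n, α > 0, and let L(k, i) > 0 be a value assigned to each consecutive block {k, …, i} ⊆ {1,…,n}. Define B_0 = 1 and T_0 = 1 and, recursively for i with m ≤ i ≤ n, B_i = Σ over k ∈ {0} ∪ {m, …, i−m} of α B_k, and T_i = Σ over k ∈ {0} ∪ {m, …, i−m} of α T_k L(k+1, i). Then B_n = Σ_P α^{|P|} and T_n = Σ_P α^{|P|} Π_{B ∈ P} L(B), where both sums range over all partitions P of {1,…,n} into consecutive blocks each of size at least m and |P| denotes the number of blocks of P. -/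
open Finset

/-- Weight of a list of block sizes. -/
noncomputable def dpW (α : ℝ) (L : ℕ → ℕ → ℝ) (l : List ℕ) : ℝ :=
  α ^ l.length * ∏ h ∈ range l.length, L ((l.take h).sum + 1) ((l.take (h + 1)).sum)

/-- The lists of block sizes at least `m` with sum `i`. -/
def dpC (m i : ℕ) : Finset (List ℕ) :=
  (univ.filter (fun p : Composition i => ∀ h, m ≤ p.blocksFun h)).image Composition.blocks

theorem dp_forall_iff {i : ℕ} (m : ℕ) (p : Composition i) :
    (∀ h, m ≤ p.blocksFun h) ↔ ∀ b ∈ p.blocks, m ≤ b := by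
  constructor
  · intro h b hb
    obtain ⟨j, hj, rfl⟩ := List.mem_iff_getElem.1 hb
    exact h ⟨j, hj⟩
  · intro h j
    exact h _ (p.blocksFun_mem_blocks j)

theorem dp_mem (m i : ℕ) (hm : 1 ≤ m) (l : List ℕ) :
    l ∈ dpC m i ↔ l.sum = i ∧ ∀ b ∈ l, m ≤ b := by
  simp only [dpC, mem_image, mem_filter, mem_univ, true_and, dp_forall_iff]
  constructor
  · rintro ⟨p, hp, rfl⟩
    exact ⟨p.blocks_sum, hp⟩
  · rintro ⟨h1, h2⟩
    exact ⟨⟨l, fun {b} hb => lt_of_lt_of_le hm (h2 b hb), h1⟩, h2, rfl⟩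

theorem dpW_append (α : ℝ) (L : ℕ → ℕ → ℝ) (l : List ℕ) (b : ℕ) :
    dpW α L (l ++ [b]) = α * dpW α L l * L (l.sum + 1) (l.sum + b) := by
  have h : ∏ h ∈ range l.length,
      L (((l ++ [b]).take h).sum + 1) (((l ++ [b]).take (h + 1)).sum)
      = ∏ h ∈ range l.length, L ((l.take h).sum + 1) ((l.take (h + 1)).sum) := by
    refine prod_congr rfl fun j hj => ?_
    have hj := mem_range.1 hj
    rw [List.take_append_of_le_length (by omega), List.take_append_of_le_length (by omega)]
  have h2 : (l ++ [b]).take (l.length + 1) = l ++ [b] := List.take_of_length_le (by simp)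
  simp only [dpW, List.length_append, List.length_singleton, prod_range_succ, h, h2,
    List.take_left', List.sum_append, List.sum_singleton]
  ring

theorem dp_sum_eq (m i : ℕ) (α : ℝ) (L : ℕ → ℕ → ℝ) :
    ∑ p ∈ univ.filter (fun p : Composition i => ∀ h, m ≤ p.blocksFun h),
      α ^ p.length * ∏ h : Fin p.length, L (p.sizeUpTo h + 1) (p.sizeUpTo (h + 1))
    = ∑ l ∈ dpC m i, dpW α L l := by
  rw [dpC, sum_image (fun p _ q _ h => Composition.ext h)]
  refine sum_congr rfl fun p _ => ?_
  rw [dpW, prod_range]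
  rfl

theorem dp_step (m i : ℕ) (hm : 1 ≤ m) (hi : m ≤ i) (α : ℝ) (L : ℕ → ℕ → ℝ) :
    ∑ l ∈ dpC m i, dpW α L l
    = ∑ k ∈ insert 0 (Icc m (i - m)), α * (∑ l ∈ dpC m k, dpW α L l) * L (k + 1) i := by
  have key : ∀ l ∈ dpC m i, ∃ l' b, l = l' ++ [b] ∧ m ≤ b ∧ l'.sum + b = i ∧
      ∀ c ∈ l', m ≤ c := by
    intro l hl
    rw [dp_mem m i hm] at hl
    rcases List.eq_nil_or_concat' l with rfl | ⟨l', b, rfl⟩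
    · simp at hl; omega
    · exact ⟨l', b, rfl, hl.2 b (by simp), by simpa using hl.1,
        fun c hc => hl.2 c (by simp [hc])⟩
  rw [← sum_fiberwise_of_maps_to (g := fun l : List ℕ => l.dropLast.sum)
    (t := insert 0 (Icc m (i - m)))]
  · refine sum_congr rfl fun k hk => ?_
    have hk' : k + m ≤ i := by
      simp only [mem_insert, mem_Icc] at hk; omega
    rw [mul_sum, sum_mul]
    refine sum_nbij' (fun l => l.dropLast) (fun l => l ++ [i - k]) ?_ ?_ ?_ ?_ ?_
    · intro l hl
      rw [mem_filter] at hl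
      obtain ⟨l', b, rfl, h1, h2, h3⟩ := key l hl.1
      rw [dp_mem m k hm]
      exact ⟨hl.2, by simpa using h3⟩
    · intro l hl
      rw [dp_mem m k hm] at hl
      rw [mem_filter, dp_mem m i hm]
      refine ⟨⟨by simp [hl.1]; omega, ?_⟩, by simpa using hl.1⟩
      intro c hc
      rcases List.mem_append.1 hc with hc | hc
      · exact hl.2 c hc
      · simp at hc; omega
    · intro l hl
      rw [mem_filter] at hl
      obtain ⟨l', b, rfl, h1, h2, h3⟩ := key l hl.1
      have := hl.2
      simp at this ⊢
      omega
    · intro l hl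
      simp
    · intro l hl
      rw [mem_filter] at hl
      obtain ⟨l', b, rfl, h1, h2, h3⟩ := key l hl.1
      have h4 : l'.sum = k := by simpa using hl.2
      rw [dpW_append, h2, h4]
      simp
  · intro l hl
    obtain ⟨l', b, rfl, h1, h2, h3⟩ := key l hl
    simp only [List.dropLast_concat, mem_insert, mem_Icc]
    rcases l' with _ | ⟨c, l''⟩
    · simp
    · right
      have := h3 c (by simp)
      simp only [List.sum_cons] at h2 ⊢
      omega

theorem dp_general (n m : ℕ) (hm1 : 1 ≤ m) (α : ℝ) (L : ℕ → ℕ → ℝ)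
    (T : ℕ → ℝ) (hT0 : T 0 = 1)
    (hTrec : ∀ i, m ≤ i → i ≤ n →
      T i = ∑ k ∈ insert 0 (Finset.Icc m (i - m)), α * T k * L (k + 1) i) (i : ℕ) :
    (i = 0 ∨ m ≤ i) → i ≤ n → T i = ∑ l ∈ dpC m i, dpW α L l := by
  induction i using Nat.strong_induction_on with
  | _ i ih =>
    intro h hin
    rcases h with rfl | h
    · have : dpC m 0 = {[]} := by
        ext l
        rw [dp_mem m 0 hm1, mem_singleton]
        constructor
        · rintro ⟨h1, h2⟩
          rcases l with _ | ⟨c, l⟩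
          · rfl
          · have := h2 c (by simp)
            simp at h1; omega
        · rintro rfl; simp
      simp [this, dpW, hT0]
    · rw [dp_step m i hm1 h, hTrec i h hin]
      refine sum_congr rfl fun k hk => ?_
      simp only [mem_insert, mem_Icc] at hk
      rw [ih k (by omega) (by omega) (by omega)]



/-- the dynamic-programming recursions
`B_0 = 1`, `B_i = ∑_{k ∈ {0} ∪ {m,…,i−m}} α B_k` and
`T_0 = 1`, `T_i = ∑_{k ∈ {0} ∪ {m,…,i−m}} α T_k L(k+1, i)` for `m ≤ i ≤ n`
compute `B_n = ∑_P α^{|P|}` and `T_n = ∑_P α^{|P|} ∏_{B ∈ P} L(B)`, where both sums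
range over all partitions `P` of `{1,…,n}` into consecutive blocks of size at least
`m` (encoded as compositions of `n`), and the block `{k+1,…,i}` has value `L(k+1,i)`. -/
theorem dp_sum_recursion (n m : ℕ) (hn : 1 ≤ n) (hm1 : 1 ≤ m) (hmn : m ≤ n)
    (α : ℝ) (hα : 0 < α) (L : ℕ → ℕ → ℝ)
    (hL : ∀ k i : ℕ, 0 < L k i)
    (B T : ℕ → ℝ) (hB0 : B 0 = 1) (hT0 : T 0 = 1)
    (hBrec : ∀ i, m ≤ i → i ≤ n →
      B i = ∑ k ∈ insert 0 (Finset.Icc m (i - m)), α * B k)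
    (hTrec : ∀ i, m ≤ i → i ≤ n →
      T i = ∑ k ∈ insert 0 (Finset.Icc m (i - m)), α * T k * L (k + 1) i) :
    B n = (∑ p ∈ Finset.univ.filter (fun p : Composition n => ∀ h, m ≤ p.blocksFun h),
        α ^ p.length)
    ∧ T n = ∑ p ∈ Finset.univ.filter (fun p : Composition n => ∀ h, m ≤ p.blocksFun h),
        α ^ p.length *
          ∏ h : Fin p.length, L (p.sizeUpTo h + 1) (p.sizeUpTo (h + 1)) := by
  constructor
  · have h := dp_general n m hm1 α (fun _ _ => 1) B hB0
      (fun i h1 h2 => by simpa using hBrec i h1 h2) n (Or.inr hmn) le_rfl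
    rw [h, ← dp_sum_eq]
    simp
  · rw [dp_sum_eq]
    exact dp_general n m hm1 α L T hT0 hTrec n (Or.inr hmn) le_rfl
end
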